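/- Let φ be the ℂ-algebra homomorphism from the free associative unital ℂ-algebra on two generators X₁, X₂ to the algebra of ℂ-linear endomorphisms of ℂ[[z]] determined by φ(X₁)=D and φ(X₂)=L. Then the kernel of φ is the two-sided ideal generated by the element X₁X₂ − X₂X₁ + X₂². -/

import Mathlib

noncomputable section

/-- The formal differentiation operator `D` on `ℂ[[z]]`: `(Df)(z) = ∑ (k+1) c_{k+1} z^k`. -/
def Dop : Module.End ℂ (PowerSeries ℂ) where
  toFun f := PowerSeries.mk fun k => ((k : ℂ) + 1) * PowerSeries.coeff (k + 1) f
  map_add' f g := by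
    ext k
    simp [mul_add]
  map_smul' c f := by
    ext k
    simp
    ring

/-- The left translation operator `L` on `ℂ[[z]]`: `(Lf)(z) = ∑ c_{k+1} z^k`. -/
def Lop : Module.End ℂ (PowerSeries ℂ) where
  toFun f := PowerSeries.mk fun k => PowerSeries.coeff (k + 1) f
  map_add' f g := by ext k; simp
  map_smul' c f := by ext k; simp

/-- The algebra homomorphism `φ` from the free associative unital `ℂ`-algebra on two
generators `X₁, X₂` to the endomorphisms of `ℂ[[z]]`, with `φ(X₁) = D`, `φ(X₂) = L`. -/
def phiDL : FreeAlgebra ℂ (Fin 2) →ₐ[ℂ] Module.End ℂ (PowerSeries ℂ) :=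
  FreeAlgebra.lift ℂ ![Dop, Lop]

/-- The monomial `X₂ⁱ X₁ʲ` in the free algebra on two generators. -/
def orderedMonomial (p : ℕ × ℕ) : FreeAlgebra ℂ (Fin 2) :=
  FreeAlgebra.ι ℂ (1 : Fin 2) ^ p.1 * FreeAlgebra.ι ℂ (0 : Fin 2) ^ p.2

/-- The relation `X₁X₂ − X₂X₁ + X₂²`. -/
def relDL : FreeAlgebra ℂ (Fin 2) :=
  FreeAlgebra.ι ℂ (0 : Fin 2) * FreeAlgebra.ι ℂ (1 : Fin 2) -
    FreeAlgebra.ι ℂ (1 : Fin 2) * FreeAlgebra.ι ℂ (0 : Fin 2) +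
    FreeAlgebra.ι ℂ (1 : Fin 2) ^ 2

lemma phiDL_ι_zero : phiDL (FreeAlgebra.ι ℂ 0) = Dop := by
  simp [phiDL]

lemma phiDL_ι_one : phiDL (FreeAlgebra.ι ℂ 1) = Lop := by
  simp [phiDL]

lemma phiDL_relDL : phiDL relDL = 0 := by
  simp only [relDL, map_add, map_sub, map_mul, map_pow, phiDL_ι_zero, phiDL_ι_one]
  ext f k
  simp [Dop, Lop, pow_two]
  ring

lemma coeff_Lop_pow (i k : ℕ) (f : PowerSeries ℂ) :
    PowerSeries.coeff k ((Lop ^ i) f) = PowerSeries.coeff (k + i) f := by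
  induction i generalizing f with
  | zero => simp
  | succ i ih =>
    rw [pow_succ, Module.End.mul_apply, ih]
    simp [Lop, add_assoc]

lemma Dop_X_pow (m : ℕ) :
    Dop (PowerSeries.X ^ m) = (m : ℂ) • PowerSeries.X ^ (m - 1) := by
  ext k
  rcases m with _ | m
  · simp [Dop, PowerSeries.coeff_one]
  · by_cases h : k = m <;> simp [Dop, PowerSeries.coeff_X_pow, h]

lemma Dop_pow_X_pow (j m : ℕ) :
    (Dop ^ j) (PowerSeries.X ^ m) = (m.descFactorial j : ℂ) • PowerSeries.X ^ (m - j) := by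
  induction j with
  | zero => simp
  | succ j ih =>
    rw [pow_succ', Module.End.mul_apply, ih, map_smul, Dop_X_pow, smul_smul,
      Nat.descFactorial_succ, Nat.sub_sub]
    push_cast
    rw [mul_comm]

lemma coeff_phiDL_orderedMonomial (p : ℕ × ℕ) (k m : ℕ) :
    PowerSeries.coeff k (phiDL (orderedMonomial p) (PowerSeries.X ^ m)) =
      if p.1 + p.2 + k = m then (m.descFactorial p.2 : ℂ) else 0 := by
  simp only [orderedMonomial, map_mul, map_pow, phiDL_ι_zero, phiDL_ι_one, Module.End.mul_apply,
    coeff_Lop_pow, Dop_pow_X_pow, map_smul, PowerSeries.coeff_X_pow, smul_eq_mul]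
  rcases lt_or_ge m p.2 with h | h
  · simp [Nat.descFactorial_of_lt h]
  · have : k + p.1 = m - p.2 ↔ p.1 + p.2 + k = m := by omega
    simp [this]

lemma linearIndependent_descPochhammer : LinearIndependent ℂ (descPochhammer ℂ) :=
  Polynomial.Sequence.linearIndependent
    { elems' := descPochhammer ℂ
      degree_eq' := fun i => by
        rw [Polynomial.degree_eq_natDegree (monic_descPochhammer ℂ i).ne_zero,
          descPochhammer_natDegree] }

lemma linearIndependent_phiDL_orderedMonomial :
    LinearIndependent ℂ fun p => phiDL (orderedMonomial p) := by
  rw [linearIndependent_iff]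
  intro a ha
  ext ⟨i, j⟩
  have key (k : ℕ) : ∑ l ∈ Finset.range (i + j + 1),
      a (i + j - l, l) * ((i + j + k).descFactorial l : ℂ) = 0 := by
    have h := congrArg (fun T => PowerSeries.coeff k (T (PowerSeries.X ^ (i + j + k)))) ha
    simp only [Finsupp.linearCombination_apply, Finsupp.sum, LinearMap.sum_apply, map_sum,
      LinearMap.smul_apply, map_smul, coeff_phiDL_orderedMonomial, smul_eq_mul,
      LinearMap.zero_apply, map_zero, Nat.add_right_cancel_iff] at h
    simp only [mul_ite, mul_zero, ← Finset.sum_filter] at h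
    rw [← h, ← Finset.Nat.sum_antidiagonal_eq_sum_range_succ
      (fun s t => a (t, s) * ((i + j + k).descFactorial s : ℂ)),
      ← Finset.Nat.sum_antidiagonal_swap]
    refine (Finset.sum_subset (fun p hp => ?_) fun p hp hp' => ?_).symm
    · simpa using (Finset.mem_filter.1 hp).2
    · have : a p = 0 := by
        by_contra h0
        exact hp' (Finset.mem_filter.2
          ⟨Finsupp.mem_support_iff.2 h0, Finset.HasAntidiagonal.mem_antidiagonal.1 hp⟩)
      simp [this]
  have hpoly : ∑ l ∈ Finset.range (i + j + 1), a (i + j - l, l) • descPochhammer ℂ l = 0 := by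
    apply Polynomial.eq_zero_of_infinite_isRoot
    refine (Set.infinite_range_of_injective (f := fun k : ℕ => ((i + j + k : ℕ) : ℂ))
      fun k l h => by simpa using h).mono ?_
    rintro _ ⟨k, rfl⟩
    simpa [Polynomial.IsRoot, Polynomial.eval_finsetSum, descPochhammer_eval_eq_descFactorial,
      -Nat.cast_add] using key k
  simpa using linearIndependent_iff'.1 linearIndependent_descPochhammer _ _ hpoly j (by simp)

lemma ι_zero_mul_ι_one_pow_mem (i : ℕ) :
    FreeAlgebra.ι ℂ (0 : Fin 2) * FreeAlgebra.ι ℂ (1 : Fin 2) ^ i -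
      FreeAlgebra.ι ℂ (1 : Fin 2) ^ i * FreeAlgebra.ι ℂ (0 : Fin 2) +
      (i : FreeAlgebra ℂ (Fin 2)) * FreeAlgebra.ι ℂ (1 : Fin 2) ^ (i + 1) ∈
      TwoSidedIdeal.span {relDL} := by
  induction i with
  | zero => simp
  | succ i ih =>
    have h := TwoSidedIdeal.add_mem _
      (TwoSidedIdeal.mul_mem_right _ _ (FreeAlgebra.ι ℂ (1 : Fin 2)) ih)
      (TwoSidedIdeal.mul_mem_left _ (FreeAlgebra.ι ℂ (1 : Fin 2) ^ i) _
        (TwoSidedIdeal.subset_span (Set.mem_singleton relDL)))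
    convert h using 1
    simp only [relDL, pow_succ, pow_zero, Nat.cast_succ]
    noncomm_ring

/-- The elements that are congruent, modulo the relation, to a combination of ordered
monomials. -/
def normalizable : Submodule ℂ (FreeAlgebra ℂ (Fin 2)) where
  carrier := {x | ∃ y ∈ Submodule.span ℂ (Set.range orderedMonomial),
    x - y ∈ TwoSidedIdeal.span {relDL}}
  zero_mem' := ⟨0, zero_mem _, by simp⟩
  add_mem' := by
    rintro x x' ⟨y, hy, h⟩ ⟨y', hy', h'⟩
    refine ⟨y + y', add_mem hy hy', ?_⟩
    rw [add_sub_add_comm]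
    exact TwoSidedIdeal.add_mem _ h h'
  smul_mem' := by
    rintro c x ⟨y, hy, h⟩
    refine ⟨c • y, Submodule.smul_mem _ c hy, ?_⟩
    rw [← smul_sub, Algebra.smul_def]
    exact TwoSidedIdeal.mul_mem_left _ _ _ h

lemma orderedMonomial_mem (p : ℕ × ℕ) : orderedMonomial p ∈ normalizable :=
  ⟨_, Submodule.subset_span ⟨p, rfl⟩, by simp⟩

lemma mem_normalizable_of_mem_span {x : FreeAlgebra ℂ (Fin 2)}
    (hx : x ∈ TwoSidedIdeal.span {relDL}) : x ∈ normalizable :=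
  ⟨0, zero_mem _, by simpa using hx⟩

lemma ι_mul_orderedMonomial_mem (v : Fin 2) (p : ℕ × ℕ) :
    FreeAlgebra.ι ℂ v * orderedMonomial p ∈ normalizable := by
  obtain ⟨i, j⟩ := p
  fin_cases v
  · have h := TwoSidedIdeal.mul_mem_right _ _ (FreeAlgebra.ι ℂ (0 : Fin 2) ^ j)
      (ι_zero_mul_ι_one_pow_mem i)
    have h' := add_mem (mem_normalizable_of_mem_span h)
      (sub_mem (orderedMonomial_mem (i, j + 1))
        (Submodule.smul_mem _ (i : ℂ) (orderedMonomial_mem (i + 1, j))))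
    convert h' using 1
    simp only [orderedMonomial, Algebra.smul_def, map_natCast, pow_succ' _ j, Fin.zero_eta]
    noncomm_ring
  · convert orderedMonomial_mem (i + 1, j) using 1
    simp [orderedMonomial, pow_succ', mul_assoc]

lemma mul_mem_normalizable (x : FreeAlgebra ℂ (Fin 2)) :
    ∀ y ∈ normalizable, x * y ∈ normalizable := by
  induction x using FreeAlgebra.induction with
  | grade0 r =>
    intro y hy
    rw [← Algebra.smul_def]
    exact Submodule.smul_mem _ r hy
  | grade1 v =>
    rintro y ⟨z, hz, h⟩
    rw [← sub_add_cancel y z, mul_add]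
    refine add_mem (mem_normalizable_of_mem_span (TwoSidedIdeal.mul_mem_left _ _ _ h)) ?_
    have hle : Submodule.span ℂ (Set.range orderedMonomial) ≤
        normalizable.comap (LinearMap.mulLeft ℂ (FreeAlgebra.ι ℂ v)) := by
      rw [Submodule.span_le]
      rintro _ ⟨p, rfl⟩
      exact ι_mul_orderedMonomial_mem v p
    exact hle hz
  | mul a b ha hb =>
    intro y hy
    rw [mul_assoc]
    exact ha _ (hb _ hy)
  | add a b ha hb =>
    intro y hy
    rw [add_mul]
    exact add_mem (ha _ hy) (hb _ hy)

lemma mem_normalizable (x : FreeAlgebra ℂ (Fin 2)) : x ∈ normalizable := by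
  have h1 : (1 : FreeAlgebra ℂ (Fin 2)) ∈ normalizable := by
    simpa [orderedMonomial] using orderedMonomial_mem (0, 0)
  simpa using mul_mem_normalizable x 1 h1

lemma phiDL_eq_zero_of_mem_span {x : FreeAlgebra ℂ (Fin 2)}
    (hx : x ∈ TwoSidedIdeal.span {relDL}) : phiDL x = 0 := by
  have hle : TwoSidedIdeal.span {relDL} ≤ TwoSidedIdeal.ker phiDL :=
    TwoSidedIdeal.span_le.2 <| by
      simpa [TwoSidedIdeal.mem_ker] using phiDL_relDL
  exact (TwoSidedIdeal.mem_ker _).1 (hle hx)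

/-- the kernel of `φ` is the two-sided ideal generated by
`X₁X₂ − X₂X₁ + X₂²`. -/
theorem ker_phiDL :
    ∀ x : FreeAlgebra ℂ (Fin 2),
      phiDL x = 0 ↔
        x ∈ TwoSidedIdeal.span
          {FreeAlgebra.ι ℂ (0 : Fin 2) * FreeAlgebra.ι ℂ (1 : Fin 2) -
            FreeAlgebra.ι ℂ (1 : Fin 2) * FreeAlgebra.ι ℂ (0 : Fin 2) +
            FreeAlgebra.ι ℂ (1 : Fin 2) ^ 2} := by
  intro x
  refine ⟨fun hx => ?_, phiDL_eq_zero_of_mem_span⟩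
  obtain ⟨y, hy, h⟩ := mem_normalizable x
  have hphi : phiDL y = 0 := by
    simpa [hx] using phiDL_eq_zero_of_mem_span h
  obtain ⟨a, rfl⟩ := (Finsupp.mem_span_range_iff_exists_finsupp).1 hy
  have ha : a = 0 := linearIndependent_iff.1 linearIndependent_phiDL_orderedMonomial a <| by
    simpa [Finsupp.linearCombination_apply, Finsupp.sum] using hphi
  rw [ha, Finsupp.sum_zero_index, sub_zero] at h
  exact h
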